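/- arXiv:1501.06019 — 2 statements merged into one kernel-verified Lean document; each statement's English description precedes it below -/
import Mathlib

section
/- Fix reals V₁ > V₂ > 0 and n₁ > n₂ > 1, and set φ* = 1 − (V₂/V₁)^{1/(n₁−n₂)}. Consider the shock from the origin O = (0,0) to Φ = (0, φ₂) on the second axis, which has speed σ = V₂(1−φ₂)^{n₂}. Then for φ₂ ∈ (0, φ*) the shock is a 1-Lax shock: λ_a(Φ) < σ < λ_b(Φ) and σ < V₂ < V₁; at φ₂ = φ* it is right-characteristic, σ = λ_b(Φ); and for φ₂ ∈ (φ*, 1) the shock is over-compressive: λ_a(Φ) < σ, λ_b(Φ) < σ, and σ < V₂ < V₁. Here λ_a(Φ) = (1 − (1+n₂)φ₂)u₂(φ₂) and λ_b(Φ) = u₁(φ₂) − φ₂u₂(φ₂). -/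
/-- Slip velocity `u(φ) = V (1-φ)^(n-1)` (real exponent). -/
noncomputable def slip (V n φ : ℝ) : ℝ := V * (1 - φ) ^ (n - 1)

theorem mul_rpow_eq_mul_slip (V n : ℝ) {φ : ℝ} (hφ : φ < 1) :
    V * (1 - φ) ^ n = (1 - φ) * slip V n φ := by
  have h : (1 - φ) ^ n = (1 - φ) ^ (n - 1) * (1 - φ) := by
    rw [← Real.rpow_add_one (sub_pos.2 hφ).ne', sub_add_cancel]
  rw [slip, h]
  ring

theorem slip_pos {V φ : ℝ} (n : ℝ) (hV : 0 < V) (hφ : φ < 1) : 0 < slip V n φ :=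
  mul_pos hV (Real.rpow_pos_of_pos (sub_pos.2 hφ) _)

theorem slip_sub_slip (V₁ V₂ n₁ n₂ : ℝ) {φ : ℝ} (hφ : φ < 1) :
    slip V₁ n₁ φ - slip V₂ n₂ φ =
      (1 - φ) ^ (n₂ - 1) * (V₁ * (1 - φ) ^ (n₁ - n₂) - V₂) := by
  have h : (1 - φ) ^ (n₁ - 1) = (1 - φ) ^ (n₂ - 1) * (1 - φ) ^ (n₁ - n₂) := by
    rw [← Real.rpow_add (sub_pos.2 hφ)]
    congr 1
    ring
  rw [slip, slip, h]
  ring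

/-- The first eigenvalue lies strictly below the shock speed. -/
theorem eigenvalue_lt_shock_speed {V n φ : ℝ} (hV : 0 < V) (hn : 0 < n) (hφ₀ : 0 < φ)
    (hφ₁ : φ < 1) : (1 - (1 + n) * φ) * slip V n φ < V * (1 - φ) ^ n := by
  rw [mul_rpow_eq_mul_slip V n hφ₁]
  refine mul_lt_mul_of_pos_right ?_ (slip_pos n hV hφ₁)
  linarith [mul_pos hn hφ₀]

theorem shock_speed_lt {V n φ : ℝ} (hV : 0 < V) (hn : 0 < n) (hφ₀ : 0 < φ) (hφ₁ : φ < 1) :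
    V * (1 - φ) ^ n < V :=
  mul_lt_of_lt_one_right hV (Real.rpow_lt_one (by linarith) (by linarith) hn)

/-- Shock classification on the second axis: the shock from the origin to `(0,φ₂)`,
of speed `σ = V₂(1-φ₂)^(n₂)`, is 1-Lax for `φ₂ ∈ (0, φ*)` (`λ_a < σ < λ_b`,
`σ < V₂ < V₁`), right-characteristic at `φ₂ = φ*` (`σ = λ_b`), and over-compressive
for `φ₂ ∈ (φ*, 1)` (`λ_a < σ`, `λ_b < σ`, `σ < V₂ < V₁`), where
`φ* = 1 - (V₂/V₁)^(1/(n₁-n₂))`. -/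
theorem shock_classification_second_axis
    (V₁ V₂ n₁ n₂ : ℝ) (hV : V₁ > V₂) (hV2 : V₂ > 0) (hn : n₁ > n₂) (hn2 : n₂ > 1) :
    (∀ φ₂ ∈ Set.Ioo (0:ℝ) (1 - (V₂ / V₁) ^ (1 / (n₁ - n₂))),
      (1 - (1 + n₂) * φ₂) * slip V₂ n₂ φ₂ < V₂ * (1 - φ₂) ^ n₂ ∧
      V₂ * (1 - φ₂) ^ n₂ < slip V₁ n₁ φ₂ - φ₂ * slip V₂ n₂ φ₂ ∧
      V₂ * (1 - φ₂) ^ n₂ < V₂ ∧ V₂ < V₁) ∧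
    (V₂ * (1 - (1 - (V₂ / V₁) ^ (1 / (n₁ - n₂)))) ^ n₂ =
      slip V₁ n₁ (1 - (V₂ / V₁) ^ (1 / (n₁ - n₂)))
        - (1 - (V₂ / V₁) ^ (1 / (n₁ - n₂)))
            * slip V₂ n₂ (1 - (V₂ / V₁) ^ (1 / (n₁ - n₂)))) ∧
    (∀ φ₂ ∈ Set.Ioo (1 - (V₂ / V₁) ^ (1 / (n₁ - n₂))) (1:ℝ),
      (1 - (1 + n₂) * φ₂) * slip V₂ n₂ φ₂ < V₂ * (1 - φ₂) ^ n₂ ∧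
      slip V₁ n₁ φ₂ - φ₂ * slip V₂ n₂ φ₂ < V₂ * (1 - φ₂) ^ n₂ ∧
      V₂ * (1 - φ₂) ^ n₂ < V₂ ∧ V₂ < V₁) := by
  have hV₁ : 0 < V₁ := hV2.trans hV
  have hd : 0 < n₁ - n₂ := sub_pos.2 hn
  have hn₂ : 0 < n₂ := by linarith
  have hq : 0 < V₂ / V₁ := div_pos hV2 hV₁
  have hx₀ : 0 < (V₂ / V₁) ^ (1 / (n₁ - n₂)) := Real.rpow_pos_of_pos hq _
  have hx₁ : (V₂ / V₁) ^ (1 / (n₁ - n₂)) < 1 :=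
    Real.rpow_lt_one hq.le ((div_lt_one hV₁).2 hV) (one_div_pos.2 hd)
  have hx : V₁ * ((V₂ / V₁) ^ (1 / (n₁ - n₂))) ^ (n₁ - n₂) = V₂ := by
    rw [← Real.rpow_mul hq.le, one_div_mul_cancel hd.ne', Real.rpow_one]
    field_simp
  generalize (V₂ / V₁) ^ (1 / (n₁ - n₂)) = x at hx₀ hx₁ hx ⊢
  refine ⟨?_, ?_, ?_⟩
  · rintro φ ⟨h₀, h⟩
    have h₁ : φ < 1 := by linarith
    refine ⟨eigenvalue_lt_shock_speed hV2 hn₂ h₀ h₁, ?_, shock_speed_lt hV2 hn₂ h₀ h₁, hV⟩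
    have hlt : V₁ * x ^ (n₁ - n₂) < V₁ * (1 - φ) ^ (n₁ - n₂) :=
      mul_lt_mul_of_pos_left (Real.rpow_lt_rpow hx₀.le (by linarith) hd) hV₁
    rw [hx] at hlt
    have hpos := mul_pos (Real.rpow_pos_of_pos (sub_pos.2 h₁) (n₂ - 1)) (sub_pos.2 hlt)
    rw [← slip_sub_slip V₁ V₂ n₁ n₂ h₁] at hpos
    rw [mul_rpow_eq_mul_slip V₂ n₂ h₁]
    linarith
  · have h₁ : 1 - x < 1 := by linarith
    have heq := slip_sub_slip V₁ V₂ n₁ n₂ h₁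
    rw [sub_sub_cancel, hx, sub_self, mul_zero] at heq
    rw [mul_rpow_eq_mul_slip V₂ n₂ h₁]
    linarith
  · rintro φ ⟨h, h₁⟩
    have h₀ : 0 < φ := by linarith
    refine ⟨eigenvalue_lt_shock_speed hV2 hn₂ h₀ h₁, ?_, shock_speed_lt hV2 hn₂ h₀ h₁, hV⟩
    have hlt : V₁ * (1 - φ) ^ (n₁ - n₂) < V₁ * x ^ (n₁ - n₂) :=
      mul_lt_mul_of_pos_left (Real.rpow_lt_rpow (by linarith) (by linarith) hd) hV₁
    rw [hx] at hlt
    have hneg := mul_neg_of_pos_of_neg (Real.rpow_pos_of_pos (sub_pos.2 h₁) (n₂ - 1))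
      (sub_neg.2 hlt)
    rw [← slip_sub_slip V₁ V₂ n₁ n₂ h₁] at hneg
    rw [mul_rpow_eq_mul_slip V₂ n₂ h₁]
    linarith
end

section
/- Fix reals V₁ > V₂ > 0 and n₁ > n₂ > 1, and set φ* = 1 − (V₂/V₁)^{1/(n₁−n₂)}. Let Φ = (φ₁, φ₂) with φ₁, φ₂ ≥ 0 and φ₁ + φ₂ = φ*. Then the shock from the origin O = (0,0) to Φ has speed σ = (1−φ*)u₁(φ*) = V₂(1−φ*)^{n₂}, the discriminant satisfies Δ(Φ) > 0, the eigenvalues of the Jacobian J(Φ) are λ₁(Φ) = σ − √Δ(Φ) and λ₂(Φ) = σ, and λ₁(Φ) < σ = λ₂(Φ) < V₂ < V₁. Hence the shock from the origin to any state on the contact line {φ₁ + φ₂ = φ*} is a 1-Lax shock that is characteristic at the right state with respect to the second family. -/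
/-- Derivative of the slip velocity, `u'(φ) = -(n-1) V (1-φ)^(n-2)`. -/
noncomputable def slip' (V n φ : ℝ) : ℝ := -(n - 1) * V * (1 - φ) ^ (n - 2)

/-- Phase velocity `w₁(Φ) = u₁(φ) - φ₁ u₁(φ) - φ₂ u₂(φ)` with `φ = φ₁ + φ₂`. -/
noncomputable def w1 (V₁ V₂ n₁ n₂ : ℝ) (Φ : ℝ × ℝ) : ℝ :=
  slip V₁ n₁ (Φ.1 + Φ.2) - Φ.1 * slip V₁ n₁ (Φ.1 + Φ.2) - Φ.2 * slip V₂ n₂ (Φ.1 + Φ.2)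

/-- Phase velocity `w₂(Φ) = u₂(φ) - φ₁ u₁(φ) - φ₂ u₂(φ)` with `φ = φ₁ + φ₂`. -/
noncomputable def w2 (V₁ V₂ n₁ n₂ : ℝ) (Φ : ℝ × ℝ) : ℝ :=
  slip V₂ n₂ (Φ.1 + Φ.2) - Φ.1 * slip V₁ n₁ (Φ.1 + Φ.2) - Φ.2 * slip V₂ n₂ (Φ.1 + Φ.2)

/-- `u_{ij}(Φ) = u_i'(φ) - (φ₁u₁'(φ) + φ₂u₂'(φ)) - u_j(φ)`, encoded via the data
`(Vi, ni)` of species `i` and `(Vj, nj)` of species `j`. -/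
noncomputable def uij (V₁ V₂ n₁ n₂ Vi ni Vj nj : ℝ) (Φ : ℝ × ℝ) : ℝ :=
  slip' Vi ni (Φ.1 + Φ.2)
    - (Φ.1 * slip' V₁ n₁ (Φ.1 + Φ.2) + Φ.2 * slip' V₂ n₂ (Φ.1 + Φ.2))
    - slip Vj nj (Φ.1 + Φ.2)

/-- Jacobian matrix of the flux `f_i(Φ) = φ_i w_i(Φ)`. -/
noncomputable def Jac (V₁ V₂ n₁ n₂ : ℝ) (Φ : ℝ × ℝ) : Matrix (Fin 2) (Fin 2) ℝ :=
  !![w1 V₁ V₂ n₁ n₂ Φ + Φ.1 * uij V₁ V₂ n₁ n₂ V₁ n₁ V₁ n₁ Φ,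
       Φ.1 * uij V₁ V₂ n₁ n₂ V₁ n₁ V₂ n₂ Φ;
     Φ.2 * uij V₁ V₂ n₁ n₂ V₂ n₂ V₁ n₁ Φ,
       w2 V₁ V₂ n₁ n₂ Φ + Φ.2 * uij V₁ V₂ n₁ n₂ V₂ n₂ V₂ n₂ Φ]

/-- Discriminant `Δ(Φ)` of the Jacobian matrix. -/
noncomputable def disc (V₁ V₂ n₁ n₂ : ℝ) (Φ : ℝ × ℝ) : ℝ :=
  ((n₁ * Φ.1 - 1) * slip V₁ n₁ (Φ.1 + Φ.2) - (n₂ * Φ.2 - 1) * slip V₂ n₂ (Φ.1 + Φ.2)) ^ 2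
    + 4 * n₁ * n₂ * Φ.1 * Φ.2 * slip V₁ n₁ (Φ.1 + Φ.2) * slip V₂ n₂ (Φ.1 + Φ.2)

/-- On the contact line `1 - φ = (V₂ / V₁) ^ (1 / (n₁ - n₂))` the two slip velocities agree. -/
theorem slip_eq_slip_of_contact {V₁ V₂ n₁ n₂ φ : ℝ} (hV₁ : 0 < V₁) (hV₂ : 0 < V₂)
    (hn : n₂ < n₁) (hφ : 1 - φ = (V₂ / V₁) ^ (1 / (n₁ - n₂))) :
    slip V₁ n₁ φ = slip V₂ n₂ φ := by
  have ha : 0 < 1 - φ := hφ ▸ Real.rpow_pos_of_pos (div_pos hV₂ hV₁) _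
  have hpow : (1 - φ) ^ (n₁ - n₂) = V₂ / V₁ := by
    rw [hφ, ← Real.rpow_mul (div_pos hV₂ hV₁).le, one_div_mul_cancel (sub_pos.2 hn).ne',
      Real.rpow_one]
  have hsplit : (1 - φ) ^ (n₁ - 1) = (1 - φ) ^ (n₁ - n₂) * (1 - φ) ^ (n₂ - 1) := by
    rw [← Real.rpow_add ha]
    ring_nf
  rw [slip, slip, hsplit, hpow]
  field_simp

theorem one_sub_mul_slip {V n φ : ℝ} (hφ : φ < 1) : (1 - φ) * slip V n φ = V * (1 - φ) ^ n := by
  rw [slip, Real.rpow_sub_one (sub_pos.2 hφ).ne']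
  field_simp [(sub_pos.2 hφ).ne']

theorem one_sub_mul_slip' {V n φ : ℝ} (hφ : φ < 1) :
    (1 - φ) * slip' V n φ = -(n - 1) * slip V n φ := by
  have h : (1 - φ) ^ (n - 1) = (1 - φ) ^ (n - 2) * (1 - φ) := by
    rw [← Real.rpow_add_one (sub_pos.2 hφ).ne']
    ring_nf
  rw [slip, slip', h]
  ring

/-- Shocks from the origin to the contact line `{φ₁+φ₂ = φ*}` are 1-Lax shocks,
characteristic at the right state with respect to the second family: the shock speed is
`σ = (1-φ*)u₁(φ*) = V₂(1-φ*)^(n₂)`, `Δ(Φ) > 0`, the eigenvalues of `J(Φ)` are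
`λ₁ = σ - √Δ(Φ)` and `λ₂ = σ`, and `λ₁ < σ = λ₂ < V₂ < V₁`. -/
theorem one_lax_shock_to_contact_line
    (V₁ V₂ n₁ n₂ : ℝ) (hV : V₁ > V₂) (hV2 : V₂ > 0) (hn : n₁ > n₂) (hn2 : n₂ > 1)
    (φs : ℝ) (hφs : φs = 1 - (V₂ / V₁) ^ (1 / (n₁ - n₂)))
    (Φ : ℝ × ℝ) (h1 : 0 ≤ Φ.1) (h2 : 0 ≤ Φ.2) (hsum : Φ.1 + Φ.2 = φs)
    (σ : ℝ) (hσ : σ = (1 - φs) * slip V₁ n₁ φs) :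
    (Φ.1 * w1 V₁ V₂ n₁ n₂ Φ = σ * Φ.1 ∧ Φ.2 * w2 V₁ V₂ n₁ n₂ Φ = σ * Φ.2) ∧
    σ = V₂ * (1 - φs) ^ n₂ ∧
    0 < disc V₁ V₂ n₁ n₂ Φ ∧
    Matrix.det (Jac V₁ V₂ n₁ n₂ Φ - σ • (1 : Matrix (Fin 2) (Fin 2) ℝ)) = 0 ∧
    Matrix.det (Jac V₁ V₂ n₁ n₂ Φ
        - (σ - Real.sqrt (disc V₁ V₂ n₁ n₂ Φ)) • (1 : Matrix (Fin 2) (Fin 2) ℝ)) = 0 ∧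
    σ - Real.sqrt (disc V₁ V₂ n₁ n₂ Φ) < σ ∧
    σ < V₂ ∧ V₂ < V₁ := by
  have hV₁ : 0 < V₁ := hV2.trans hV
  have hφ : 1 - φs = (V₂ / V₁) ^ (1 / (n₁ - n₂)) := by rw [hφs]; ring
  have hφs_lt : φs < 1 :=
    sub_pos.1 (hφ ▸ Real.rpow_pos_of_pos (div_pos hV2 hV₁) _)
  have hφs_pos : 0 < φs := by
    have : (V₂ / V₁) ^ (1 / (n₁ - n₂)) < 1 :=
      Real.rpow_lt_one (div_pos hV2 hV₁).le ((div_lt_one hV₁).2 hV)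
        (one_div_pos.2 (sub_pos.2 hn))
    linarith
  have hslip : slip V₁ n₁ φs = slip V₂ n₂ φs := slip_eq_slip_of_contact hV₁ hV2 hn hφ
  have hσ₂ : σ = V₂ * (1 - φs) ^ n₂ := by rw [hσ, hslip, one_sub_mul_slip hφs_lt]
  have d₁ := one_sub_mul_slip' (V := V₁) (n := n₁) hφs_lt
  have d₂ := one_sub_mul_slip' (V := V₂) (n := n₂) hφs_lt
  have hu : 0 < slip V₂ n₂ φs := mul_pos hV2 (Real.rpow_pos_of_pos (sub_pos.2 hφs_lt) _)
  have hσ_lt : σ < V₂ := by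
    rw [hσ₂]
    exact mul_lt_of_lt_one_right hV2
      (Real.rpow_lt_one (sub_pos.2 hφs_lt).le (by linarith) (by linarith))
  have hm : 0 < n₁ * Φ.1 + n₂ * Φ.2 := by nlinarith
  rw [hslip] at hσ d₁
  have hw₁ : w1 V₁ V₂ n₁ n₂ Φ = σ := by
    rw [w1, hsum, hslip, hσ, ← hsum]; ring
  have hw₂ : w2 V₁ V₂ n₁ n₂ Φ = σ := by
    rw [w2, hsum, hslip, hσ, ← hsum]; ring
  have hdisc : disc V₁ V₂ n₁ n₂ Φ = ((n₁ * Φ.1 + n₂ * Φ.2) * slip V₂ n₂ φs) ^ 2 := by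
    rw [disc, hsum, hslip]; ring
  have hroot : 0 < (n₁ * Φ.1 + n₂ * Φ.2) * slip V₂ n₂ φs := mul_pos hm hu
  rw [hdisc, Real.sqrt_sq hroot.le]
  refine ⟨⟨by rw [hw₁, mul_comm], by rw [hw₂, mul_comm]⟩, hσ₂, by positivity, ?_, ?_,
    sub_lt_self _ hroot, hσ_lt, hV⟩
  · simp only [Matrix.det_fin_two, Jac, uij, hw₁, hw₂, hsum, hslip, Matrix.sub_apply,
      Matrix.smul_apply, Matrix.of_apply, Matrix.cons_val', Matrix.cons_val_zero,
      Matrix.cons_val_one, Matrix.cons_val_fin_one, Matrix.one_apply_eq, ne_eq, one_ne_zero,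
      zero_ne_one, not_false_eq_true, Matrix.one_apply_ne, smul_eq_mul]
    ring
  · simp only [Matrix.det_fin_two, Jac, uij, hw₁, hw₂, hsum, hslip, Matrix.sub_apply,
      Matrix.smul_apply, Matrix.of_apply, Matrix.cons_val', Matrix.cons_val_zero,
      Matrix.cons_val_one, Matrix.cons_val_fin_one, Matrix.one_apply_eq, ne_eq, one_ne_zero,
      zero_ne_one, not_false_eq_true, Matrix.one_apply_ne, smul_eq_mul]
    rw [← hsum] at d₁ d₂ ⊢
    linear_combination ((n₁ * Φ.1 + n₂ * Φ.2) * slip V₂ n₂ (Φ.1 + Φ.2)) * (Φ.1 * d₁ + Φ.2 * d₂)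
end
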